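/- Let x, y, z be Gaussian integers with xyz ≠ 0, gcd(x, y) a unit, x not divisible by 1+i, y divisible by 1+i, and z^2 = x^4 + 6x^2y^2 + y^4. Then there exist Gaussian integers u' and v' such that u' + v' = z, u' - v' = x^2 + y^2, u'·v' = (x·y)^2, and u' and v' are coprime (their gcd is a unit). -/

import Mathlib

open Zsqrtd

theorem aux_sq (a : GaussianInt) (h : (1 + sqrtd : GaussianInt) ∣ a ^ 2) :
    (1 + sqrtd : GaussianInt) ∣ a := by
  obtain ⟨c, hc⟩ := h
  have h1 := congrArg Zsqrtd.re hc
  simp [pow_two] at h1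
  have h2 : (2 : ℤ) ∣ a.re + a.im := by
    have h4 := congrArg Zsqrtd.im hc
    simp [pow_two] at h4
    have h3 : (2 : ℤ) ∣ (a.re + a.im) ^ 2 := by
      exact ⟨c.re + a.im * a.im, by linarith⟩
    exact Int.prime_two.dvd_of_dvd_pow h3
  obtain ⟨k, hk⟩ := h2
  refine ⟨⟨k, k - a.re⟩, ?_⟩
  ext
  · simp
  · simp
    linarith

/-- Resolvent factorization for Mordell's quartic over `ℤ[i]`: if `x, y, z`
are Gaussian integers with `x * y * z ≠ 0`, `gcd (x, y)` a unit, `x` odd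
(not divisible by `1 + i`), `y` even (divisible by `1 + i`), and
`z² = x⁴ + 6x²y² + y⁴`, then there exist coprime Gaussian integers `u'` and
`v'` with `u' + v' = z`, `u' - v' = x² + y²`, and `u'·v' = (x·y)²`. -/
theorem mordell_resolvent_factorization (x y z : GaussianInt)
    (hxyz : x * y * z ≠ 0)
    (hgcd : ∀ d : GaussianInt, d ∣ x → d ∣ y → IsUnit d)
    (hx : ¬ (1 + sqrtd) ∣ x) (hy : (1 + sqrtd) ∣ y)
    (heq : z ^ 2 = x ^ 4 + 6 * x ^ 2 * y ^ 2 + y ^ 4) :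
    ∃ u' v' : GaussianInt, u' + v' = z ∧ u' - v' = x ^ 2 + y ^ 2 ∧
      u' * v' = (x * y) ^ 2 ∧
      (∀ d : GaussianInt, d ∣ u' → d ∣ v' → IsUnit d) := by
  have hI : (1 + sqrtd : GaussianInt) * (1 - sqrtd) = 2 := by
    ext <;> simp
  have hJ : (1 + sqrtd : GaussianInt) ^ 2 * (-sqrtd) = 2 := by
    ext <;> simp [pow_two]
  have h0 : (1 + sqrtd : GaussianInt) ≠ 0 := by
    intro h
    have := congrArg Zsqrtd.im h
    simp at this
  have h20 : (2 : GaussianInt) ≠ 0 := by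
    intro h
    have := congrArg Zsqrtd.re h
    simp at this
  have hxy : IsCoprime x y := by
    rw [← EuclideanDomain.gcd_isUnit_iff]
    exact hgcd _ (EuclideanDomain.gcd_dvd_left x y) (EuclideanDomain.gcd_dvd_right x y)
  have hdiv : (2 : GaussianInt) ∣ z - (x ^ 2 + y ^ 2) := by
    obtain ⟨b, hb⟩ := aux_sq (z - (x ^ 2 + y ^ 2))
      ⟨(1 - sqrtd) * (2 * (x * y) ^ 2 - (x ^ 2 + y ^ 2) * (z - (x ^ 2 + y ^ 2))), by
        rw [← mul_assoc, hI]; linear_combination heq⟩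
    have hz : z = (1 + sqrtd) * b + (x ^ 2 + y ^ 2) := by linear_combination hb
    have hb2 : (1 + sqrtd) ∣ b ^ 2 := by
      have h3 : (1 + sqrtd : GaussianInt) ^ 2 * b ^ 2 + 2 * (x ^ 2 + y ^ 2) * (1 + sqrtd) * b
          = 4 * (x * y) ^ 2 := by
        rw [hz] at heq
        linear_combination heq
      refine ⟨(1 + sqrtd) * (-sqrtd) ^ 2 * (x * y) ^ 2
        - (-sqrtd) * (x ^ 2 + y ^ 2) * b, ?_⟩
      apply mul_left_cancel₀ (pow_ne_zero 2 h0)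
      generalize (sqrtd : GaussianInt) = I at *
      linear_combination h3 + ((x ^ 2 + y ^ 2) * (1 + I) * b - ((1 + I) ^ 2 * (-I) + 2) * (x * y) ^ 2) * hJ
    obtain ⟨c, hc⟩ := aux_sq b hb2
    refine ⟨sqrtd * c, ?_⟩
    have hK : (1 + sqrtd : GaussianInt) ^ 2 = 2 * sqrtd := by
      ext <;> simp [pow_two]
    rw [hb, hc]
    linear_combination c * hK
  obtain ⟨v, hv⟩ := hdiv
  have hz : z = 2 * v + (x ^ 2 + y ^ 2) := by linear_combination hv
  have huv : (v + (x ^ 2 + y ^ 2)) * v = (x * y) ^ 2 := by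
    apply mul_left_cancel₀ (pow_ne_zero 2 h20)
    rw [hz] at heq
    linear_combination heq
  refine ⟨v + (x ^ 2 + y ^ 2), v, by rw [hz]; ring, by ring, huv, ?_⟩
  intro d hd1 hd2
  have hw : d ∣ x ^ 2 + y ^ 2 := (dvd_add_right hd2).1 hd1
  have hxy2 : d ∣ (x * y) ^ 2 := huv ▸ Dvd.dvd.mul_left hd2 _
  have hc : IsCoprime ((x * y) ^ 2) (x ^ 2 + y ^ 2) := by
    apply IsCoprime.pow_left
    apply IsCoprime.mul_left
    · have h := (hxy.pow_right (n := 2)).add_mul_left_right x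
      have e : x ^ 2 + y ^ 2 = y ^ 2 + x * x := by ring
      rw [e]; exact h
    · have h := (hxy.symm.pow_right (n := 2)).add_mul_left_right y
      have e : x ^ 2 + y ^ 2 = x ^ 2 + y * y := by ring
      rw [e]; exact h
  exact hc.isUnit_of_dvd' hxy2 hw
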